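/- arXiv:2310.10836 — 8 statements merged into one kernel-verified Lean document; each statement's English description precedes it below -/
import Mathlib

section
/- Let ψ : [1,∞) → [1,∞) be a normalization shape. Let a : W → ℝ be square-summable with a(∅) = 1, and suppose a(w) ≠ 0 for some nonempty word w. Then there exists a unique λ > 0 such that Σ_{w∈W} λ^{2|w|} a(w)² = ψ(‖a‖); moreover this λ satisfies 0 < λ ≤ 1, and ‖δ_λ a‖² = ψ(‖a‖) ≤ sup_{x≥1} ψ(x), so ‖δ_λ a‖ is bounded uniformly in a. -/
namespace WordDilation

variable {α : Type*} {a : List α → ℝ} {l m : ℝ}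

lemma term_le_term (hl : 0 ≤ l) (hlm : l ≤ m) (w : List α) :
    l ^ (2 * w.length) * a w ^ 2 ≤ m ^ (2 * w.length) * a w ^ 2 := by
  gcongr

lemma summable_mono (hl : 0 ≤ l) (hlm : l ≤ m)
    (hm : Summable fun w : List α => m ^ (2 * w.length) * a w ^ 2) :
    Summable fun w : List α => l ^ (2 * w.length) * a w ^ 2 :=
  hm.of_nonneg_of_le (fun w => by positivity) (term_le_term hl hlm)

lemma tsum_strict_mono (hne : ∃ w : List α, w ≠ [] ∧ a w ≠ 0) (hl : 0 ≤ l) (hlm : l < m)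
    (hm : Summable fun w : List α => m ^ (2 * w.length) * a w ^ 2) :
    ∑' w : List α, l ^ (2 * w.length) * a w ^ 2 < ∑' w : List α, m ^ (2 * w.length) * a w ^ 2 := by
  obtain ⟨w, hw, haw⟩ := hne
  refine Summable.tsum_lt_tsum (i := w) (term_le_term hl hlm.le) ?_ (summable_mono hl hlm.le hm) hm
  have hlen : 2 * w.length ≠ 0 := by simpa using hw
  gcongr

lemma summable_of_tsum_pos (h : 0 < ∑' w : List α, l ^ (2 * w.length) * a w ^ 2) :
    Summable fun w : List α => l ^ (2 * w.length) * a w ^ 2 := by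
  by_contra hs
  exact h.ne' (tsum_eq_zero_of_not_summable hs)

lemma tsum_injOn (hne : ∃ w : List α, w ≠ [] ∧ a w ≠ 0) (hl : 0 ≤ l) (hm : 0 ≤ m)
    (hpos : 0 < ∑' w : List α, l ^ (2 * w.length) * a w ^ 2)
    (h : ∑' w : List α, l ^ (2 * w.length) * a w ^ 2
      = ∑' w : List α, m ^ (2 * w.length) * a w ^ 2) : l = m := by
  rcases lt_trichotomy l m with hlt | heq | hgt
  · exact absurd h (tsum_strict_mono hne hl hlt (summable_of_tsum_pos (h ▸ hpos))).ne
  · exact heq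
  · exact absurd h (tsum_strict_mono hne hm hgt (summable_of_tsum_pos hpos)).ne'

lemma tsum_zero : ∑' w : List α, (0 : ℝ) ^ (2 * w.length) * a w ^ 2 = a [] ^ 2 := by
  rw [tsum_eq_single []]
  · simp
  · intro w hw
    simp [hw]

lemma continuousOn_tsum_Icc (ha : Summable fun w => a w ^ 2) :
    ContinuousOn (fun l : ℝ => ∑' w : List α, l ^ (2 * w.length) * a w ^ 2) (Set.Icc 0 1) := by
  refine continuousOn_tsum (fun w => by fun_prop) ha fun w l hl => ?_
  rw [Real.norm_of_nonneg (mul_nonneg (pow_nonneg hl.1 _) (sq_nonneg _))]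
  exact mul_le_of_le_one_left (sq_nonneg _) (pow_le_one₀ hl.1 hl.2)

lemma sq_nil_lt_tsum (ha : Summable fun w => a w ^ 2)
    (hne : ∃ w : List α, w ≠ [] ∧ a w ≠ 0) : a [] ^ 2 < ∑' w, a w ^ 2 := by
  have h := tsum_strict_mono (l := 0) (m := 1) hne le_rfl one_pos (by simpa using ha)
  rw [tsum_zero] at h
  simpa using h

end WordDilation



/-- A normalization shape: a function `ψ : [1,∞) → [1,∞)` that is bounded, injective,
Lipschitz, with `ψ 1 = 1` and `ψ x ≤ x ^ 2` for all `x ≥ 1`.  It is modeled as a function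
on `ℝ` whose relevant properties are required on `Set.Ici 1`. -/
structure NormShape (ψ : ℝ → ℝ) : Prop where
  mem_Ici : ∀ x : ℝ, 1 ≤ x → 1 ≤ ψ x
  bounded : ∃ B : ℝ, ∀ x : ℝ, 1 ≤ x → ψ x ≤ B
  injOn : Set.InjOn ψ (Set.Ici 1)
  lipschitz : ∃ K : ℝ, ∀ x : ℝ, 1 ≤ x → ∀ y : ℝ, 1 ≤ y → |ψ x - ψ y| ≤ K * |x - y|
  map_one : ψ 1 = 1
  le_sq : ∀ x : ℝ, 1 ≤ x → ψ x ≤ x ^ 2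

/-- Existence and uniqueness of the normalization constant `λ` with
`∑ λ^{2|w|} a(w)² = ψ(‖a‖)`; moreover `0 < λ ≤ 1`, `‖δ_λ a‖² = ψ(‖a‖) ≤ sup_{x ≥ 1} ψ x`. -/
theorem normalization_constant_exists_unique
    {d : ℕ} (hd : 1 ≤ d) {ψ : ℝ → ℝ} (hψ : NormShape ψ)
    (a : List (Fin d) → ℝ) (ha : Summable fun w => a w ^ 2) (h0 : a [] = 1)
    (hne : ∃ w : List (Fin d), w ≠ [] ∧ a w ≠ 0) :
    (∃! l : ℝ, 0 < l ∧
      ∑' w : List (Fin d), l ^ (2 * w.length) * a w ^ 2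
        = ψ (Real.sqrt (∑' w : List (Fin d), a w ^ 2))) ∧
    (∀ l : ℝ, 0 < l →
      ∑' w : List (Fin d), l ^ (2 * w.length) * a w ^ 2
        = ψ (Real.sqrt (∑' w : List (Fin d), a w ^ 2)) →
      l ≤ 1 ∧
      ∑' w : List (Fin d), (l ^ w.length * a w) ^ 2
        = ψ (Real.sqrt (∑' w : List (Fin d), a w ^ 2)) ∧
      ψ (Real.sqrt (∑' w : List (Fin d), a w ^ 2)) ≤ sSup (ψ '' Set.Ici 1)) := by
  have hS : 1 < ∑' w, a w ^ 2 := by simpa [h0] using WordDilation.sq_nil_lt_tsum ha hne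
  have hR : 1 < Real.sqrt (∑' w, a w ^ 2) := by rwa [Real.lt_sqrt zero_le_one, one_pow]
  have hψ_gt : 1 < ψ (Real.sqrt (∑' w, a w ^ 2)) := by
    refine lt_of_le_of_ne (hψ.mem_Ici _ hR.le) fun h => hR.ne ?_
    exact hψ.injOn Set.self_mem_Ici hR.le (hψ.map_one.trans h)
  have hψ_le : ψ (Real.sqrt (∑' w, a w ^ 2)) ≤ ∑' w, a w ^ 2 := by
    simpa [Real.sq_sqrt (zero_le_one.trans hS.le)] using hψ.le_sq _ hR.le
  refine ⟨?_, fun l hl h => ⟨?_, ?_, ?_⟩⟩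
  · obtain ⟨l, hl, h⟩ := intermediate_value_Icc zero_le_one
      (WordDilation.continuousOn_tsum_Icc ha)
      (show ψ (Real.sqrt (∑' w, a w ^ 2)) ∈ Set.Icc _ _ from
        ⟨by simpa only [WordDilation.tsum_zero, h0, one_pow] using hψ_gt.le,
          by simpa using hψ_le⟩)
    have hl0 : l ≠ 0 := by
      rintro rfl
      simp only [WordDilation.tsum_zero, h0, one_pow] at h
      exact hψ_gt.ne h
    refine ⟨l, ⟨hl.1.lt_of_ne' hl0, h⟩, fun m hm => ?_⟩
    exact WordDilation.tsum_injOn hne hm.1.le hl.1 (hm.2 ▸ zero_lt_one.trans hψ_gt)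
      (hm.2.trans h.symm)
  · by_contra! hl1
    have hlt := WordDilation.tsum_strict_mono hne zero_le_one hl1
      (WordDilation.summable_of_tsum_pos (h ▸ zero_lt_one.trans hψ_gt))
    simp only [one_pow, one_mul] at hlt
    exact (hlt.trans_le (h.trans_le hψ_le)).false
  · simpa only [mul_pow, ← pow_mul, mul_comm 2] using h
  · obtain ⟨B, hB⟩ := hψ.bounded
    exact le_csSup ⟨B, Set.forall_mem_image.2 hB⟩ (Set.mem_image_of_mem ψ hR.le)
end

section
/- Let ψ : [1,∞) → [1,∞) be a normalization shape. Let a, b : W → ℝ be square-summable with a(∅) = b(∅) = 1, and let λ_a, λ_b > 0 satisfy the defining equations ‖δ_{λ_a} a‖² = ψ(‖a‖) and ‖δ_{λ_b} b‖² = ψ(‖b‖). If δ_{λ_a} a = δ_{λ_b} b, then a = b. (That is, the normalization map Λ(a) = δ_{λ(a)} a is injective.) -/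
/-- If two square-summable families with equal `ℓ²` norm agree after dilation by positive
factors `la ≤ lb`, then they are equal. -/
theorem eq_of_dilation_eq_of_le {α : Type*} {a b : List α → ℝ}
    (ha : Summable fun w => a w ^ 2) (hb : Summable fun w => b w ^ 2)
    (hab : ∑' w, a w ^ 2 = ∑' w, b w ^ 2) {la lb : ℝ} (hla : 0 < la) (hle : la ≤ lb)
    (heq : ∀ w : List α, la ^ w.length * a w = lb ^ w.length * b w) : a = b := by
  have hlb : 0 < lb := hla.trans_le hle
  have hsq : ∀ w, (la ^ w.length) ^ 2 * a w ^ 2 = (lb ^ w.length) ^ 2 * b w ^ 2 := fun w => by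
    rw [← mul_pow, ← mul_pow, heq]
  have hba : ∀ w, b w ^ 2 ≤ a w ^ 2 := fun w => by
    have hpow : (la ^ w.length) ^ 2 ≤ (lb ^ w.length) ^ 2 := by gcongr
    have hpos : 0 < (lb ^ w.length) ^ 2 := by positivity
    refine le_of_mul_le_mul_left ?_ hpos
    rw [← hsq w]
    exact mul_le_mul_of_nonneg_right hpow (sq_nonneg _)
  funext w
  have hw : b w ^ 2 = a w ^ 2 := by
    by_contra hne
    exact (hb.tsum_lt_tsum hba (lt_of_le_of_ne (hba w) hne) ha).ne hab.symm
  have h := hsq w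
  rw [hw] at h
  rcases eq_or_ne (a w) 0 with h0 | h0
  · rw [h0] at hw ⊢
    exact (pow_eq_zero_iff two_ne_zero).1 (hw.trans (zero_pow two_ne_zero)) |>.symm
  · have hpow : la ^ w.length = lb ^ w.length :=
      (pow_left_inj₀ (by positivity) (by positivity) two_ne_zero).1
        (mul_right_cancel₀ (pow_ne_zero 2 h0) h)
    have hw' := heq w
    rw [hpow] at hw'
    exact mul_left_cancel₀ (by positivity) hw'

/-- A square-summable family with unit component at the empty word has norm at least one. -/
theorem one_le_sqrt_tsum_sq {α : Type*} {a : List α → ℝ}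
    (ha : Summable fun w => a w ^ 2) (h0 : a [] = 1) : 1 ≤ √(∑' w, a w ^ 2) := by
  rw [Real.one_le_sqrt]
  simpa [h0] using ha.le_tsum [] fun w _ => sq_nonneg (a w)

/-- The normalization map `Λ(a) = δ_{λ(a)} a` is injective: if the
normalized elements coincide, the original elements coincide. -/
theorem normalization_injective
    {d : ℕ} (hd : 1 ≤ d) {ψ : ℝ → ℝ} (hψ : NormShape ψ)
    (a b : List (Fin d) → ℝ)
    (ha : Summable fun w => a w ^ 2) (hb : Summable fun w => b w ^ 2)
    (h0a : a [] = 1) (h0b : b [] = 1)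
    (la lb : ℝ) (hla : 0 < la) (hlb : 0 < lb)
    (hna : ∑' w : List (Fin d), (la ^ w.length * a w) ^ 2
        = ψ (Real.sqrt (∑' w : List (Fin d), a w ^ 2)))
    (hnb : ∑' w : List (Fin d), (lb ^ w.length * b w) ^ 2
        = ψ (Real.sqrt (∑' w : List (Fin d), b w ^ 2)))
    (heq : ∀ w : List (Fin d), la ^ w.length * a w = lb ^ w.length * b w) :
    a = b := by
  have hnorm : √(∑' w, a w ^ 2) = √(∑' w, b w ^ 2) := by
    refine hψ.injOn (one_le_sqrt_tsum_sq ha h0a) (one_le_sqrt_tsum_sq hb h0b) ?_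
    rw [← hna, ← hnb]
    simp only [heq]
  have hab : ∑' w, a w ^ 2 = ∑' w, b w ^ 2 :=
    (Real.sqrt_inj (tsum_nonneg fun w => sq_nonneg _) (tsum_nonneg fun w => sq_nonneg _)).1 hnorm
  rcases le_total la lb with hle | hle
  · exact eq_of_dilation_eq_of_le ha hb hab hla hle heq
  · exact (eq_of_dilation_eq_of_le hb ha hab.symm hlb hle fun w => (heq w).symm).symm
end

section
/- Let ψ : [1,∞) → [1,∞) be a normalization shape. Let a : W → ℝ be square-summable with a(∅) = 1 and a(w) ≠ 0 for some nonempty word w; set r = min{ |w| : w ≠ ∅, a(w) ≠ 0 }. For L ∈ ℕ let a_L be the truncation of a defined by a_L(w) = a(w) if |w| ≤ L and a_L(w) = 0 otherwise. For L ≥ r let λ_L ∈ (0,1] be the unique positive solution of ‖δ_{λ_L} a_L‖² = ψ(‖a_L‖), and let λ ∈ (0,1] be the unique positive solution of ‖δ_λ a‖² = ψ(‖a‖). Then λ_L → λ as L → ∞. -/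
open Filter Topology in
/-- The sums of the truncations of a summable family by a grading converge to the full sum. -/
theorem tendsto_tsum_sq_truncation {ι : Type*} (ℓ : ι → ℕ) {a : ι → ℝ}
    (ha : Summable fun i => a i ^ 2) :
    Tendsto (fun L : ℕ => ∑' i, (if ℓ i ≤ L then a i else 0) ^ 2) atTop
      (𝓝 (∑' i, a i ^ 2)) := by
  refine tendsto_tsum_of_dominated_convergence ha (fun i => ?_) (Eventually.of_forall fun L i => ?_)
  · refine tendsto_const_nhds.congr' ?_
    filter_upwards [eventually_ge_atTop (ℓ i)] with L hL
    rw [if_pos hL]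
  · split_ifs <;> simp [sq_nonneg]

theorem sq_truncation_le (p : Prop) [Decidable p] (x : ℝ) : (if p then x else 0) ^ 2 ≤ x ^ 2 := by
  split_ifs <;> simp [sq_nonneg]

theorem summable_sq_truncation {ι : Type*} (ℓ : ι → ℕ) {a : ι → ℝ}
    (ha : Summable fun i => a i ^ 2) (L : ℕ) :
    Summable fun i => (if ℓ i ≤ L then a i else 0) ^ 2 :=
  ha.of_nonneg_of_le (fun _ => sq_nonneg _) fun _ => sq_truncation_le _ _

theorem sq_dilation_le {x : ℝ} (hx : 0 ≤ x) (hx1 : x ≤ 1) (n : ℕ) (b : ℝ) :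
    (x ^ n * b) ^ 2 ≤ b ^ 2 := by
  rw [mul_pow]
  exact mul_le_of_le_one_left (sq_nonneg b) (pow_le_one₀ (by positivity) (pow_le_one₀ hx hx1))

theorem summable_sq_dilation {ι : Type*} (ℓ : ι → ℕ) {a : ι → ℝ}
    (ha : Summable fun i => a i ^ 2) {x : ℝ} (hx : 0 ≤ x) (hx1 : x ≤ 1) :
    Summable fun i => (x ^ ℓ i * a i) ^ 2 :=
  ha.of_nonneg_of_le (fun _ => sq_nonneg _) fun _ => sq_dilation_le hx hx1 _ _

/-- Truncation changes the squared norm of a contracted family by at most the tail. -/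
theorem abs_tsum_sq_dilation_sub_truncation_le {ι : Type*} (ℓ : ι → ℕ) {a : ι → ℝ}
    (ha : Summable fun i => a i ^ 2) {x : ℝ} (hx : 0 ≤ x) (hx1 : x ≤ 1) (L : ℕ) :
    |(∑' i, (x ^ ℓ i * a i) ^ 2) - ∑' i, (x ^ ℓ i * (if ℓ i ≤ L then a i else 0)) ^ 2|
      ≤ (∑' i, a i ^ 2) - ∑' i, (if ℓ i ≤ L then a i else 0) ^ 2 := by
  have hL := summable_sq_truncation ℓ ha L
  have hx2 := summable_sq_dilation ℓ ha hx hx1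
  have hxL := summable_sq_dilation ℓ hL hx hx1
  rw [← hx2.tsum_sub hxL, ← ha.tsum_sub hL, abs_of_nonneg]
  · refine (hx2.sub hxL).tsum_le_tsum (fun i => ?_) (ha.sub hL)
    split_ifs
    · simp
    · simpa using sq_dilation_le hx hx1 (ℓ i) (a i)
  · refine tsum_nonneg fun i => ?_
    split_ifs <;> simp [sq_nonneg]

/-- Each coordinate bounds from below the variation of the squared norm under dilation. -/
theorem mul_sub_pow_le_tsum_sq_dilation_sub {ι : Type*} (ℓ : ι → ℕ) {a : ι → ℝ}
    (ha : Summable fun i => a i ^ 2) {x y : ℝ} (hx : 0 ≤ x) (hxy : x ≤ y) (hy1 : y ≤ 1) (i : ι) :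
    a i ^ 2 * ((y ^ ℓ i) ^ 2 - (x ^ ℓ i) ^ 2)
      ≤ (∑' j, (y ^ ℓ j * a j) ^ 2) - ∑' j, (x ^ ℓ j * a j) ^ 2 := by
  have hsy := summable_sq_dilation ℓ ha (hx.trans hxy) hy1
  have hsx := summable_sq_dilation ℓ ha hx (hxy.trans hy1)
  rw [← hsy.tsum_sub hsx]
  calc a i ^ 2 * ((y ^ ℓ i) ^ 2 - (x ^ ℓ i) ^ 2)
      = (y ^ ℓ i * a i) ^ 2 - (x ^ ℓ i * a i) ^ 2 := by ring
    _ ≤ _ := (hsy.sub hsx).le_tsum i fun j _ => by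
      rw [sub_nonneg, mul_pow, mul_pow]
      gcongr

theorem mul_abs_sub_pow_le_abs_tsum_sq_dilation_sub {ι : Type*} (ℓ : ι → ℕ) {a : ι → ℝ}
    (ha : Summable fun i => a i ^ 2) {x y : ℝ} (hx : 0 ≤ x) (hx1 : x ≤ 1) (hy : 0 ≤ y)
    (hy1 : y ≤ 1) (i : ι) :
    a i ^ 2 * |(x ^ ℓ i) ^ 2 - (y ^ ℓ i) ^ 2|
      ≤ |(∑' j, (x ^ ℓ j * a j) ^ 2) - ∑' j, (y ^ ℓ j * a j) ^ 2| := by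
  rcases le_total x y with h | h
  · have hp : (x ^ ℓ i) ^ 2 ≤ (y ^ ℓ i) ^ 2 := by gcongr
    rw [abs_sub_comm, abs_of_nonneg (sub_nonneg.2 hp), abs_sub_comm]
    exact (mul_sub_pow_le_tsum_sq_dilation_sub ℓ ha hx h hy1 i).trans (le_abs_self _)
  · have hp : (y ^ ℓ i) ^ 2 ≤ (x ^ ℓ i) ^ 2 := by gcongr
    rw [abs_of_nonneg (sub_nonneg.2 hp)]
    exact (mul_sub_pow_le_tsum_sq_dilation_sub ℓ ha hy h hx1 i).trans (le_abs_self _)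

open Filter Topology in
theorem tendsto_of_tendsto_pow {α : Type*} {l : Filter α} {u : α → ℝ} {c : ℝ} {n : ℕ}
    (hn : n ≠ 0) (hu : ∀ᶠ i in l, 0 ≤ u i) (hc : 0 ≤ c)
    (h : Tendsto (fun i => u i ^ n) l (𝓝 (c ^ n))) : Tendsto u l (𝓝 c) := by
  have h2 := h.rpow_const (p := (n : ℝ)⁻¹) (Or.inr (by positivity))
  rw [Real.pow_rpow_inv_natCast hc hn] at h2
  refine h2.congr' ?_
  filter_upwards [hu] with i hi
  exact Real.pow_rpow_inv_natCast hi hn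

open Filter Topology in
theorem NormShape.tendsto_comp {ψ : ℝ → ℝ} (hψ : NormShape ψ) {α : Type*} {l : Filter α}
    {u : α → ℝ} {c : ℝ} (hu : ∀ i, 1 ≤ u i) (hc : 1 ≤ c) (h : Tendsto u l (𝓝 c)) :
    Tendsto (fun i => ψ (u i)) l (𝓝 (ψ c)) := by
  obtain ⟨K, hK⟩ := hψ.lipschitz
  rw [tendsto_iff_dist_tendsto_zero] at h ⊢
  refine squeeze_zero (fun _ => dist_nonneg) (fun i => hK _ (hu i) _ hc) ?_
  simpa [Real.dist_eq] using h.const_mul K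

/-- The normalization constants `λ_L` of the truncations `a_L` converge,
as `L → ∞`, to the normalization constant `λ` of `a`. -/
theorem truncated_normalization_constant_tendsto
    {d : ℕ} (hd : 1 ≤ d) {ψ : ℝ → ℝ} (hψ : NormShape ψ)
    (a : List (Fin d) → ℝ) (ha : Summable fun w => a w ^ 2) (h0 : a [] = 1)
    (hne : ∃ w : List (Fin d), w ≠ [] ∧ a w ≠ 0)
    (r : ℕ) (hr : r = sInf {n : ℕ | ∃ w : List (Fin d), w ≠ [] ∧ a w ≠ 0 ∧ w.length = n})
    (lamL : ℕ → ℝ) (lam : ℝ)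
    (hlamL : ∀ L : ℕ, r ≤ L → 0 < lamL L ∧ lamL L ≤ 1 ∧
      ∑' w : List (Fin d), (lamL L ^ w.length * (if w.length ≤ L then a w else 0)) ^ 2
        = ψ (Real.sqrt (∑' w : List (Fin d), (if w.length ≤ L then a w else 0) ^ 2)))
    (hlam : 0 < lam) (hlam1 : lam ≤ 1)
    (hlameq : ∑' w : List (Fin d), (lam ^ w.length * a w) ^ 2
        = ψ (Real.sqrt (∑' w : List (Fin d), a w ^ 2))) :
    Filter.Tendsto lamL Filter.atTop (nhds lam) := by
  obtain ⟨w, hw, haw⟩ := hne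
  have hSL := tendsto_tsum_sq_truncation List.length ha
  have hNL : ∀ L : ℕ, 1 ≤ Real.sqrt
      (∑' w : List (Fin d), (if w.length ≤ L then a w else 0) ^ 2) := fun L => by
    rw [Real.one_le_sqrt]
    simpa [h0] using
      (summable_sq_truncation List.length ha L).le_tsum [] fun _ _ => sq_nonneg _
  have hN : 1 ≤ Real.sqrt (∑' w : List (Fin d), a w ^ 2) := by
    rw [Real.one_le_sqrt]
    simpa [h0] using ha.le_tsum [] fun _ _ => sq_nonneg _
  have hψL := hψ.tendsto_comp hNL hN hSL.sqrt
  have hev : ∀ᶠ L in Filter.atTop, r ≤ L := Filter.eventually_ge_atTop r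
  have hF : Filter.Tendsto (fun L => ∑' w : List (Fin d), (lamL L ^ w.length * a w) ^ 2)
      Filter.atTop (nhds (∑' w : List (Fin d), (lam ^ w.length * a w) ^ 2)) := by
    rw [hlameq]
    refine (tendsto_iff_of_dist (squeeze_zero' (Filter.Eventually.of_forall fun _ => dist_nonneg) ?_
      (sub_self (∑' w : List (Fin d), a w ^ 2) ▸ hSL.const_sub _))).2 hψL
    filter_upwards [hev] with L hL
    obtain ⟨hpos, hle, heq⟩ := hlamL L hL
    rw [← heq]
    exact abs_tsum_sq_dilation_sub_truncation_le List.length ha hpos.le hle L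
  have hpow : Filter.Tendsto (fun L => lamL L ^ (w.length * 2)) Filter.atTop
      (nhds (lam ^ (w.length * 2))) := by
    rw [tendsto_iff_dist_tendsto_zero] at hF ⊢
    refine squeeze_zero' (Filter.Eventually.of_forall fun _ => dist_nonneg) ?_
      (by simpa using hF.const_mul (a w ^ 2)⁻¹)
    filter_upwards [hev] with L hL
    obtain ⟨hpos, hle, -⟩ := hlamL L hL
    rw [le_inv_mul_iff₀ (by positivity), pow_mul, pow_mul]
    exact mul_abs_sub_pow_le_abs_tsum_sq_dilation_sub List.length ha hpos.le hle hlam.le hlam1 w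
  refine tendsto_of_tendsto_pow (by simpa using hw) ?_ hlam.le hpow
  filter_upwards [hev] with L hL
  exact (hlamL L hL).1.le
end

section
/- Let ψ : [1,∞) → [1,∞) be a normalization shape. Let a : W → ℝ be square-summable with a(∅) = 1 and a(w) ≠ 0 for some nonempty word w; set r = min{ |w| : w ≠ ∅, a(w) ≠ 0 } and ρ = (Σ_{|w| = r} a(w)²)^{1/2} > 0. For L ≥ r let a_L be the truncation of a at level L, let λ_L > 0 satisfy ‖δ_{λ_L} a_L‖² = ψ(‖a_L‖), and let λ > 0 satisfy ‖δ_λ a‖² = ψ(‖a‖). Then |λ_L^r − λ^r| ≤ ‖δ_{λ_L} a_L − δ_λ a‖ / ρ. -/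
/-- If the dilated squares sum (as a `tsum`) to the value of a normalization shape at the norm
of a square-summable tensor with unit scalar part, then they are genuinely summable. -/
theorem NormShape.summable_of_tsum_eq {α : Type*} {ψ : ℝ → ℝ} (hψ : NormShape ψ)
    {f b : α → ℝ} (hb : Summable fun w => b w ^ 2) {w₀ : α} (h₀ : b w₀ = 1)
    (h : ∑' w, f w = ψ (Real.sqrt (∑' w, b w ^ 2))) : Summable f := by
  by_contra hf
  have hone : 1 ≤ ∑' w, b w ^ 2 := by
    simpa [h₀] using hb.le_tsum w₀ fun w _ => sq_nonneg (b w)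
  have hge := hψ.mem_Ici _ (Real.one_le_sqrt.mpr hone)
  rw [← h, tsum_eq_zero_of_not_summable hf] at hge
  linarith

theorem Summable.sub_sq {α : Type*} {f g : α → ℝ} (hf : Summable fun w => f w ^ 2)
    (hg : Summable fun w => g w ^ 2) : Summable fun w => (f w - g w) ^ 2 :=
  Summable.of_nonneg_of_le (fun _ => sq_nonneg _)
    (fun w => by nlinarith [sq_nonneg (f w + g w)]) ((hf.mul_left 2).add (hg.mul_left 2))

/-- Key estimate for the convergence rate: with `r` the first level at
which `a` has a nonzero component and `ρ = (∑_{|w| = r} a(w)²)^{1/2}`, one has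
`|λ_L^r − λ^r| ≤ ‖δ_{λ_L} a_L − δ_λ a‖ / ρ`. -/
theorem truncated_normalization_pow_r_estimate
    {d : ℕ} (hd : 1 ≤ d) {ψ : ℝ → ℝ} (hψ : NormShape ψ)
    (a : List (Fin d) → ℝ) (ha : Summable fun w => a w ^ 2) (h0 : a [] = 1)
    (hne : ∃ w : List (Fin d), w ≠ [] ∧ a w ≠ 0)
    (r : ℕ) (hr : r = sInf {n : ℕ | ∃ w : List (Fin d), w ≠ [] ∧ a w ≠ 0 ∧ w.length = n})
    (ρ : ℝ) (hρ : ρ = Real.sqrt (∑' w : {w : List (Fin d) // w.length = r}, a w.1 ^ 2))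
    (L : ℕ) (hL : r ≤ L)
    (lamL lam : ℝ) (hlamL : 0 < lamL) (hlam : 0 < lam)
    (heqL : ∑' w : List (Fin d), (lamL ^ w.length * (if w.length ≤ L then a w else 0)) ^ 2
        = ψ (Real.sqrt (∑' w : List (Fin d), (if w.length ≤ L then a w else 0) ^ 2)))
    (heq : ∑' w : List (Fin d), (lam ^ w.length * a w) ^ 2
        = ψ (Real.sqrt (∑' w : List (Fin d), a w ^ 2))) :
    |lamL ^ r - lam ^ r| ≤
      Real.sqrt (∑' w : List (Fin d),
          (lamL ^ w.length * (if w.length ≤ L then a w else 0)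
            - lam ^ w.length * a w) ^ 2) / ρ := by
  have hmem := Nat.sInf_mem (s := {n : ℕ | ∃ w : List (Fin d), w ≠ [] ∧ a w ≠ 0 ∧ w.length = n})
    (by obtain ⟨w, hw, haw⟩ := hne; exact ⟨w.length, w, hw, haw, rfl⟩)
  rw [← hr] at hmem
  obtain ⟨v, -, hav, hvr⟩ := hmem
  have hlevel : Summable fun w : {w : List (Fin d) // w.length = r} => a w.1 ^ 2 :=
    ha.comp_injective Subtype.val_injective
  have hsum_pos : 0 < ∑' w : {w : List (Fin d) // w.length = r}, a w.1 ^ 2 :=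
    hlevel.tsum_pos (fun w => sq_nonneg _) ⟨v, hvr⟩ (by positivity)
  have hρ_pos : 0 < ρ := hρ ▸ Real.sqrt_pos.mpr hsum_pos
  have htrunc : Summable fun w : List (Fin d) => (if w.length ≤ L then a w else 0) ^ 2 :=
    Summable.of_nonneg_of_le (fun _ => sq_nonneg _)
      (fun w => by split_ifs <;> simp [sq_nonneg]) ha
  have hsub := (hψ.summable_of_tsum_eq htrunc (w₀ := []) (by simp [h0]) heqL).sub_sq
    (hψ.summable_of_tsum_eq ha h0 heq)
  rw [le_div_iff₀ hρ_pos]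
  apply Real.le_sqrt_of_sq_le
  calc (|lamL ^ r - lam ^ r| * ρ) ^ 2
      = ∑' w : {w : List (Fin d) // w.length = r}, (lamL ^ r - lam ^ r) ^ 2 * a w.1 ^ 2 := by
        rw [mul_pow, sq_abs, hρ, Real.sq_sqrt hsum_pos.le, tsum_mul_left]
    _ = ∑' w : {w : List (Fin d) // w.length = r},
          (lamL ^ w.1.length * (if w.1.length ≤ L then a w.1 else 0)
            - lam ^ w.1.length * a w.1) ^ 2 := by
        refine tsum_congr fun w => ?_
        rw [w.2, if_pos hL]
        ring
    _ ≤ _ := hsub.tsum_subtype_le _ {w | w.length = r} (fun _ => sq_nonneg _)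
end

section
/- Fix d ≥ 1 and L ≥ 1, and let W_L denote the (finite) set of nonempty words over {1,…,d} of length at most L, so that the truncated tensor space is modeled by E = (W_L → ℝ) with ‖t‖ = (1 + Σ_{w∈W_L} t(w)²)^{1/2} (the 1 accounting for the zeroth component). Let ψ : [1,∞) → [1,∞) be a C¹ normalization shape. Let t̄ ∈ E with t̄ ≠ 0. Then there exist an open neighbourhood U of t̄ in E and a C¹ function λ : U → (0,∞) such that 1 + Σ_{w∈W_L} λ(t)^{2|w|} t(w)² = ψ(‖t‖) for every t ∈ U, and the partial derivative of λ at t̄ in the coordinate w ∈ W_L equals t̄(w) · ( ψ'(‖t̄‖)/(2‖t̄‖) − λ(t̄)^{2|w|} ) / ( Σ_{k=1}^{L} k · λ(t̄)^{2k−1} · Σ_{|v| = k} t̄(v)² ). -/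
/-- Index type for the nonempty words of length at most `L` over the alphabet `Fin d`:
a word of length `n + 1` (with `n < L`) is a function `Fin (n + 1) → Fin d`. -/
abbrev WordIdx (d L : ℕ) : Type := Σ n : Fin L, Fin ((n : ℕ) + 1) → Fin d

/-- The length of the word encoded by an index. -/
abbrev wordLen {d L : ℕ} (w : WordIdx d L) : ℕ := (w.1 : ℕ) + 1

open Topology in
/-- The implicit function theorem for a scalar equation `f (x, y) = f (a, b)` in a scalar unknown
`y`, with the directional derivatives of the solution expressed through partial derivatives. -/
theorem ContDiffAt.exists_implicit_scalar {E : Type*} [NormedAddCommGroup E] [NormedSpace ℝ E]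
    [CompleteSpace E] {f : E × ℝ → ℝ} {a : E} {b c : ℝ} (hf : ContDiffAt ℝ 1 f (a, b))
    (hc : HasDerivAt (fun y => f (a, y)) c b) (hc0 : c ≠ 0) :
    ∃ g : E → ℝ, g a = b ∧ ContDiffAt ℝ 1 g a ∧ (∀ᶠ x in 𝓝 a, f (x, g x) = f (a, b)) ∧
      ∀ v m, HasDerivAt (fun s : ℝ => f (a + s • v, b)) m 0 → fderiv ℝ g a v = -m / c := by
  have hdf : HasFDerivAt f (fderiv ℝ f (a, b)) (a, b) :=
    (hf.differentiableAt one_ne_zero).hasFDerivAt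
  have hy : fderiv ℝ f (a, b) (0, 1) = c :=
    (hdf.comp_hasDerivAt b ((hasDerivAt_const b a).prodMk (hasDerivAt_id b))).unique hc
  have hinv : (fderiv ℝ f (a, b) ∘L .inr ℝ E ℝ).IsInvertible := by
    refine ⟨ContinuousLinearEquiv.unitsEquivAut ℝ (Units.mk0 c hc0), ?_⟩
    ext
    simp [hy]
  have hg := hf.contDiffAt_implicitFunction one_ne_zero hinv
  have hga := hf.implicitFunction_apply_self one_ne_zero hinv
  have hev := hf.eventually_apply_implicitFunction one_ne_zero hinv
  set g := hf.implicitFunction one_ne_zero hinv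
  dsimp only at hg hga hev
  refine ⟨g, hga, hg, hev, fun v m hm => ?_⟩
  have hv : fderiv ℝ f (a, b) (v, 0) = m := by
    have hline : HasDerivAt (fun s : ℝ => (a + s • v, b)) (v, 0) 0 := by
      have := ((hasDerivAt_id (0 : ℝ)).smul_const v).const_add a
      simpa using this.prodMk (hasDerivAt_const (0 : ℝ) b)
    have hdf' : HasFDerivAt f (fderiv ℝ f (a, b)) (a + (0 : ℝ) • v, b) := by simpa using hdf
    exact (hdf'.comp_hasDerivAt (0 : ℝ) hline).unique hm
  have hdg : HasFDerivAt g (fderiv ℝ g a) a := (hg.differentiableAt one_ne_zero).hasFDerivAt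
  have hdf' : HasFDerivAt f (fderiv ℝ f (a, b)) (a, g a) := by rwa [hga]
  have hzero := ((hdf'.comp a ((hasFDerivAt_id a).prodMk hdg)).congr_of_eventuallyEq
    (hev.mono fun x hx => hx.symm)).unique (hasFDerivAt_const (f (a, b)) a)
  have happ := congrArg (fun T : E →L[ℝ] ℝ => T v) hzero
  have hsplit : ((v, fderiv ℝ g a v) : E × ℝ) = (v, 0) + fderiv ℝ g a v • ((0 : E), (1 : ℝ)) := by
    simp
  simp only [ContinuousLinearMap.comp_apply, ContinuousLinearMap.prod_apply,
    ContinuousLinearMap.id_apply, zero_apply] at happ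
  rw [hsplit, map_add, map_smul, hv, hy, smul_eq_mul] at happ
  rw [eq_div_iff hc0]
  linarith

/-- A polynomial with nonnegative coefficients `a i` in the positive powers `x ^ p i` attains every
value strictly above its constant term and at most its value at `1` at some positive point. -/
theorem exists_pos_one_add_sum_pow_mul_eq {ι : Type*} [Fintype ι] (p : ι → ℕ) (a : ι → ℝ)
    (hp : ∀ i, p i ≠ 0) {y : ℝ} (hy : 1 < y) (hy' : y ≤ 1 + ∑ i, a i) :
    ∃ x : ℝ, 0 < x ∧ 1 + ∑ i, x ^ p i * a i = y := by
  have hcont : ContinuousOn (fun x : ℝ => 1 + ∑ i, x ^ p i * a i) (Set.Icc 0 1) := by fun_prop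
  obtain ⟨x, hx, hxy⟩ := intermediate_value_Icc zero_le_one hcont
    (show y ∈ Set.Icc _ _ by simpa [hp] using ⟨hy.le, hy'⟩)
  refine ⟨x, hx.1.lt_of_ne ?_, hxy⟩
  rintro rfl
  simp [hp] at hxy
  exact hy.ne hxy

/-- Local `C¹` regularity of the normalization constant on the truncated
tensor space `E = (W_L → ℝ)` (with norm `‖t‖ = (1 + ∑_w t(w)²)^{1/2}`), together with the
explicit formula for its partial derivatives, obtained from the implicit function theorem. -/
theorem normalization_constant_C1_gradient
    (d L : ℕ) (hd : 1 ≤ d) (hL : 1 ≤ L) (ψ : ℝ → ℝ)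
    (hψ : NormShape ψ) (hψC1 : ContDiffOn ℝ 1 ψ (Set.Ici 1))
    (tb : EuclideanSpace ℝ (WordIdx d L)) (htb : tb ≠ 0) :
    ∃ U : Set (EuclideanSpace ℝ (WordIdx d L)), IsOpen U ∧ tb ∈ U ∧
      ∃ lam : EuclideanSpace ℝ (WordIdx d L) → ℝ,
        ContDiffOn ℝ 1 lam U ∧
        (∀ t ∈ U, 0 < lam t) ∧
        (∀ t ∈ U, 1 + ∑ w : WordIdx d L, lam t ^ (2 * wordLen w) * t w ^ 2
          = ψ (Real.sqrt (1 + ∑ w : WordIdx d L, t w ^ 2))) ∧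
        (∀ w : WordIdx d L,
          fderiv ℝ lam tb (EuclideanSpace.single w 1)
            = tb w *
                (derivWithin ψ (Set.Ici 1)
                    (Real.sqrt (1 + ∑ v : WordIdx d L, tb v ^ 2))
                  / (2 * Real.sqrt (1 + ∑ v : WordIdx d L, tb v ^ 2))
                - lam tb ^ (2 * wordLen w))
              / ∑ n : Fin L, ((n : ℕ) + 1 : ℝ) * lam tb ^ (2 * ((n : ℕ) + 1) - 1)
                  * ∑ f : Fin ((n : ℕ) + 1) → Fin d, tb ⟨n, f⟩ ^ 2) := by
  set N := Real.sqrt (1 + ∑ v : WordIdx d L, tb v ^ 2) with hN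
  obtain ⟨w₀, hw₀⟩ : ∃ w, tb w ≠ 0 := by
    by_contra! h
    exact htb (by ext w; simpa using h w)
  have hS : 0 < ∑ v : WordIdx d L, tb v ^ 2 :=
    Finset.sum_pos' (fun v _ => sq_nonneg _) ⟨w₀, Finset.mem_univ _, by positivity⟩
  have hNsq : N ^ 2 = 1 + ∑ v : WordIdx d L, tb v ^ 2 := Real.sq_sqrt (by positivity)
  have hN1 : 1 < N := Real.lt_sqrt_of_sq_lt (by linarith)
  have hψN : 1 < ψ N := by
    refine (hψ.mem_Ici N hN1.le).lt_of_ne fun h => hN1.ne ?_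
    exact hψ.injOn Set.self_mem_Ici hN1.le (hψ.map_one.trans h)
  obtain ⟨l, hl, hleq⟩ := exists_pos_one_add_sum_pow_mul_eq
    (fun w : WordIdx d L => 2 * wordLen w) (fun w => tb w ^ 2) (fun w => by simp) hψN
    (hNsq ▸ hψ.le_sq N hN1.le)
  have hψat : ContDiffAt ℝ 1 ψ N := hψC1.contDiffAt (Ici_mem_nhds hN1)
  have hψderiv : HasDerivAt ψ (derivWithin ψ (Set.Ici 1) N) N := by
    rw [derivWithin_of_mem_nhds (Ici_mem_nhds hN1)]
    exact (hψat.differentiableAt one_ne_zero).hasDerivAt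
  let D : ℝ := ∑ n : Fin L, ((n : ℕ) + 1 : ℝ) * l ^ (2 * ((n : ℕ) + 1) - 1)
    * ∑ f : Fin ((n : ℕ) + 1) → Fin d, tb ⟨n, f⟩ ^ 2
  have hD : D = ∑ w : WordIdx d L, (wordLen w : ℝ) * l ^ (2 * wordLen w - 1) * tb w ^ 2 := by
    simp [D, Fintype.sum_sigma, Finset.mul_sum]
  have hDpos : 0 < D := by
    rw [hD]
    exact Finset.sum_pos' (fun v _ => by positivity) ⟨w₀, Finset.mem_univ _, by positivity⟩
  let f : EuclideanSpace ℝ (WordIdx d L) × ℝ → ℝ := fun q =>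
    1 + ∑ w : WordIdx d L, q.2 ^ (2 * wordLen w) * q.1 w ^ 2
      - ψ (Real.sqrt (1 + ∑ w : WordIdx d L, q.1 w ^ 2))
  have hf0 : f (tb, l) = 0 := sub_eq_zero.2 hleq
  have hf : ContDiffAt ℝ 1 f (tb, l) := by
    have hsqrt : ContDiffAt ℝ 1 (fun q : EuclideanSpace ℝ (WordIdx d L) × ℝ =>
        Real.sqrt (1 + ∑ w : WordIdx d L, q.1 w ^ 2)) (tb, l) := by
      refine ContDiffAt.sqrt (by fun_prop) ?_
      dsimp only
      positivity
    refine ContDiffAt.sub (by fun_prop) (ContDiffAt.comp (tb, l) (g := ψ) hψat hsqrt)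
  have hfl : HasDerivAt (fun y => f (tb, y)) (2 * D) l := by
    have h := ((HasDerivAt.fun_sum fun (w : WordIdx d L) (_ : w ∈ Finset.univ) =>
      ((hasDerivAt_pow (2 * wordLen w) l).mul_const (tb w ^ 2))).const_add 1).sub_const (ψ N)
    refine h.congr_deriv ?_
    rw [hD, Finset.mul_sum]
    refine Finset.sum_congr rfl fun w _ => ?_
    push_cast
    ring
  obtain ⟨g, hgl, hg, hev, hgd⟩ := hf.exists_implicit_scalar hfl (by positivity)
  obtain ⟨V, hV, hgV⟩ := hg.contDiffOn le_rfl (by simp)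
  have hpos : ∀ᶠ t in nhds tb, 0 < g t :=
    hg.continuousAt.eventually (lt_mem_nhds (hgl.symm ▸ hl))
  obtain ⟨U, hUsub, hU, htU⟩ := mem_nhds_iff.1 (Filter.inter_mem hV (hpos.and hev))
  refine ⟨U, hU, htU, g, hgV.mono fun t ht => (hUsub ht).1, fun t ht => (hUsub ht).2.1,
    fun t ht => sub_eq_zero.1 ((hUsub ht).2.2.trans hf0), fun w => ?_⟩
  have hline : HasDerivAt (fun s : ℝ => f (tb + s • EuclideanSpace.single w 1, l))
      (2 * l ^ (2 * wordLen w) * tb w - derivWithin ψ (Set.Ici 1) N * (tb w / N)) 0 := by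
    have hcoord : ∀ v : WordIdx d L, HasDerivAt
        (fun s : ℝ => (tb + s • EuclideanSpace.single w (1 : ℝ)) v ^ 2)
        (2 * tb v * if v = w then 1 else 0) 0 := fun v => by
      have h := (((hasDerivAt_id (0 : ℝ)).mul_const (if v = w then 1 else 0)).const_add
        (tb v)).fun_pow 2
      simpa [Pi.single_apply] using h
    have hsq : HasDerivAt
        (fun s : ℝ => 1 + ∑ v, (tb + s • EuclideanSpace.single w (1 : ℝ)) v ^ 2) (2 * tb w) 0 := by
      simpa using (HasDerivAt.fun_sum fun v (_ : v ∈ Finset.univ) => hcoord v).const_add 1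
    have hpoly : HasDerivAt (fun s : ℝ => 1 + ∑ v, l ^ (2 * wordLen v) *
        (tb + s • EuclideanSpace.single w (1 : ℝ)) v ^ 2) (l ^ (2 * wordLen w) * (2 * tb w)) 0 := by
      simpa using (HasDerivAt.fun_sum fun v (_ : v ∈ Finset.univ) =>
        (hcoord v).const_mul (l ^ (2 * wordLen v))).const_add 1
    have hsqrt := hsq.sqrt (by simp only [zero_smul, add_zero]; positivity)
    simp only [zero_smul, add_zero, ← hN] at hsqrt
    have hcomp := HasDerivAt.comp_of_eq (0 : ℝ) hψderiv hsqrt (by simp [hN])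
    refine (hpoly.sub hcomp).congr_deriv ?_
    field_simp
  rw [hgd _ _ hline, hgl]
  change _ = _ / D
  field_simp
  ring
end

section
/- (Chen's identity.) Fix d ≥ 1, T > 0 and functions f i : ℝ → ℝ (i ∈ Fin d) integrable on [0,T]. Let h : W → ℝ → ℝ → ℝ satisfy h ∅ s t = 1 and h (w ++ [i]) s t = ∫_s^t h w s u · f i (u) du for all words w, letters i and 0 ≤ s ≤ t ≤ T. Then for every word w of length n and all 0 ≤ s ≤ u ≤ t ≤ T, h w s t = Σ_{k=0}^{n} h (w.take k) s u · h (w.drop k) u t, where w.take k and w.drop k are the prefix of length k and the corresponding suffix of w. -/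
open MeasureTheory intervalIntegral

/-- Iterated integrals are continuous in their upper endpoint. -/
theorem continuousOn_iteratedIntegral {ι : Type*} {T : ℝ} {f : ι → ℝ → ℝ}
    (hf : ∀ i, IntervalIntegrable (f i) volume 0 T)
    {h : List ι → ℝ → ℝ → ℝ}
    (hnil : ∀ s t : ℝ, h [] s t = 1)
    (hrec : ∀ (w : List ι) (i : ι) (s t : ℝ), 0 ≤ s → s ≤ t → t ≤ T →
      h (w ++ [i]) s t = ∫ u in s..t, h w s u * f i u)
    (w : List ι) {s : ℝ} (hs : 0 ≤ s) (hsT : s ≤ T) :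
    ContinuousOn (h w s) (Set.Icc s T) := by
  induction w using List.reverseRecOn with
  | nil => exact continuousOn_const.congr fun t _ => hnil s t
  | append_singleton w i ih =>
    have hfi : IntervalIntegrable (f i) volume s T :=
      (hf i).mono_set (Set.uIcc_subset_uIcc
        (Set.mem_uIcc_of_le hs hsT) Set.right_mem_uIcc)
    rw [← Set.uIcc_of_le hsT] at ih ⊢
    refine (continuousOn_primitive_interval'
      (hfi.continuousOn_mul ih) Set.left_mem_uIcc).congr fun t ht => ?_
    rw [Set.uIcc_of_le hsT] at ht
    exact hrec w i s t hs ht.1 ht.2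

/-- The integrands in the recursion for iterated integrals are integrable. -/
theorem intervalIntegrable_iteratedIntegral_mul {ι : Type*} {T : ℝ} {f : ι → ℝ → ℝ}
    (hf : ∀ i, IntervalIntegrable (f i) volume 0 T)
    {h : List ι → ℝ → ℝ → ℝ}
    (hnil : ∀ s t : ℝ, h [] s t = 1)
    (hrec : ∀ (w : List ι) (i : ι) (s t : ℝ), 0 ≤ s → s ≤ t → t ≤ T →
      h (w ++ [i]) s t = ∫ u in s..t, h w s u * f i u)
    (w : List ι) (i : ι) {s a b : ℝ} (hs : 0 ≤ s) (hsa : s ≤ a) (hab : a ≤ b) (hbT : b ≤ T) :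
    IntervalIntegrable (fun v => h w s v * f i v) volume a b := by
  have hfi : IntervalIntegrable (f i) volume a b :=
    (hf i).mono_set (Set.uIcc_subset_uIcc
      (Set.mem_uIcc_of_le (by linarith) (by linarith))
      (Set.mem_uIcc_of_le (by linarith) hbT))
  refine hfi.continuousOn_mul ((continuousOn_iteratedIntegral hf hnil hrec w hs
    (by linarith)).mono ?_)
  rw [Set.uIcc_of_le hab]
  exact Set.Icc_subset_Icc hsa hbT

/-- **Chen's identity.** If `h` is the family of iterated integrals of the
integrable coordinate derivatives `f i` (determined by `h ∅ s t = 1` and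
`h (w ++ [i]) s t = ∫_s^t h w s u · f i u du`), then for every word `w` of length `n`
and all `0 ≤ s ≤ u ≤ t ≤ T`,
`h w s t = ∑_{k=0}^{n} h (w.take k) s u · h (w.drop k) u t`. -/
theorem chen_identity
    (d : ℕ) (hd : 1 ≤ d) (T : ℝ) (hT : 0 < T)
    (f : Fin d → ℝ → ℝ)
    (hf : ∀ i, IntervalIntegrable (f i) volume 0 T)
    (h : List (Fin d) → ℝ → ℝ → ℝ)
    (hnil : ∀ s t : ℝ, h [] s t = 1)
    (hrec : ∀ (w : List (Fin d)) (i : Fin d) (s t : ℝ), 0 ≤ s → s ≤ t → t ≤ T →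
      h (w ++ [i]) s t = ∫ u in s..t, h w s u * f i u)
    (w : List (Fin d)) (s u t : ℝ)
    (hs : 0 ≤ s) (hsu : s ≤ u) (hut : u ≤ t) (htT : t ≤ T) :
    h w s t = ∑ k ∈ Finset.range (w.length + 1), h (w.take k) s u * h (w.drop k) u t := by
  induction w using List.reverseRecOn generalizing t with
  | nil => simp [hnil]
  | append_singleton w i ih =>
    have hint := intervalIntegrable_iteratedIntegral_mul hf hnil hrec
    have hsplit : h (w ++ [i]) s t
        = h (w ++ [i]) s u + ∫ v in u..t, h w s v * f i v := by
      rw [hrec w i s t hs (hsu.trans hut) htT, hrec w i s u hs hsu (hut.trans htT),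
        integral_add_adjacent_intervals (hint w i hs le_rfl hsu (hut.trans htT))
          (hint w i hs hsu hut htT)]
    have hexpand : ∫ v in u..t, h w s v * f i v
        = ∑ k ∈ Finset.range (w.length + 1),
            h (w.take k) s u * h (w.drop k ++ [i]) u t := by
      calc ∫ v in u..t, h w s v * f i v
          = ∫ v in u..t, ∑ k ∈ Finset.range (w.length + 1),
              h (w.take k) s u * (h (w.drop k) u v * f i v) := by
            refine integral_congr fun v hv => ?_
            rw [Set.uIcc_of_le hut] at hv
            simp only [ih v hv.1 (hv.2.trans htT), Finset.sum_mul, mul_assoc]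
        _ = _ := by
            rw [integral_finsetSum fun k _ =>
              (hint (w.drop k) i (hs.trans hsu) le_rfl hut htT).const_mul _]
            refine Finset.sum_congr rfl fun k _ => ?_
            rw [intervalIntegral.integral_const_mul,
              hrec (w.drop k) i u t (hs.trans hsu) hut htT]
    rw [hsplit, hexpand, List.length_append, List.length_singleton,
      Finset.sum_range_succ _ (w.length + 1), add_comm]
    congr 1
    · refine Finset.sum_congr rfl fun k hk => ?_
      have hk : k ≤ w.length := Nat.lt_succ_iff.mp (Finset.mem_range.mp hk)
      rw [List.take_append_of_le_length hk, List.drop_append_of_le_length hk]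
    · rw [List.take_of_length_le (by simp), List.drop_of_length_le (by simp), hnil, mul_one]
end

section
/- (Invariance of the signature under reparametrization.) Fix d ≥ 1 and T > 0. Let f i : ℝ → ℝ (i ∈ Fin d) be continuous on [0,T], and let φ : [0,T] → [0,T] be C¹, monotone increasing and surjective (so φ(0) = 0 and φ(T) = T). Let h be the iterated integrals of f and let h̃ be the iterated integrals of g, where g i (u) = f i (φ(u)) · φ'(u). Then h̃ w 0 T = h w 0 T for every word w. -/
open MeasureTheory intervalIntegral

/-- Change of variables on `[0, t]` along a monotone function differentiable on `[0, T]`,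
with the derivative taken within `[0, T]`. -/
lemma integral_comp_mul_derivWithin_Icc_of_monotoneOn {T t : ℝ} (ht : t ∈ Set.Icc 0 T)
    {φ : ℝ → ℝ} (hφ : DifferentiableOn ℝ φ (Set.Icc 0 T)) (hmono : MonotoneOn φ (Set.Icc 0 T))
    (g : ℝ → ℝ) :
    ∫ u in (0 : ℝ)..t, g (φ u) * derivWithin φ (Set.Icc 0 T) u = ∫ u in φ 0..φ t, g u := by
  refine integral_comp_mul_deriv_of_deriv_nonneg (g := g) ?_ (fun x hx => ?_)
    (fun x _ => hmono.derivWithin_nonneg)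
  · rw [Set.uIcc_of_le ht.1]
    exact hφ.continuousOn.mono (Set.Icc_subset_Icc_right ht.2)
  · rw [min_eq_left ht.1, max_eq_right ht.1] at hx
    have hxT : x < T := hx.2.trans_le ht.2
    exact (hφ x ⟨hx.1.le, hxT.le⟩).hasDerivWithinAt.hasDerivAt (Icc_mem_nhds hx.1 hxT)

/-- Invariance of the signature under reparametrization: if `φ` is a
`C¹`, monotone increasing surjection of `[0,T]` onto itself, and `h̃` is the family of
iterated integrals of `g i = (f i ∘ φ) · φ'` while `h` is that of `f`, then
`h̃ w 0 T = h w 0 T` for every word `w`. -/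
theorem signature_reparametrization_invariance
    (d : ℕ) (hd : 1 ≤ d) (T : ℝ) (hT : 0 < T)
    (f : Fin d → ℝ → ℝ)
    (hf : ∀ i, ContinuousOn (f i) (Set.Icc 0 T))
    (φ : ℝ → ℝ)
    (hφC1 : ContDiffOn ℝ 1 φ (Set.Icc 0 T))
    (hφmono : MonotoneOn φ (Set.Icc 0 T))
    (hφmaps : Set.MapsTo φ (Set.Icc 0 T) (Set.Icc 0 T))
    (hφsurj : Set.SurjOn φ (Set.Icc 0 T) (Set.Icc 0 T))
    (h htilde : List (Fin d) → ℝ → ℝ → ℝ)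
    (hnil : ∀ s t : ℝ, h [] s t = 1)
    (hrec : ∀ (w : List (Fin d)) (i : Fin d) (s t : ℝ), 0 ≤ s → s ≤ t → t ≤ T →
      h (w ++ [i]) s t = ∫ u in s..t, h w s u * f i u)
    (htnil : ∀ s t : ℝ, htilde [] s t = 1)
    (htrec : ∀ (w : List (Fin d)) (i : Fin d) (s t : ℝ), 0 ≤ s → s ≤ t → t ≤ T →
      htilde (w ++ [i]) s t
        = ∫ u in s..t, htilde w s u * (f i (φ u) * derivWithin φ (Set.Icc 0 T) u))
    (w : List (Fin d)) :
    htilde w 0 T = h w 0 T := by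
  have h0 : (0 : ℝ) ∈ Set.Icc 0 T := ⟨le_rfl, hT.le⟩
  have hTmem : T ∈ Set.Icc 0 T := ⟨hT.le, le_rfl⟩
  have hφ0 : φ 0 = 0 := by
    obtain ⟨x, hx, hx0⟩ := hφsurj h0
    exact le_antisymm (hx0 ▸ hφmono h0 hx hx.1) (hφmaps h0).1
  have hφT : φ T = T := by
    obtain ⟨x, hx, hxT⟩ := hφsurj hTmem
    exact le_antisymm (hφmaps hTmem).2 (hxT.symm.le.trans (hφmono hx hTmem hx.2))
  have key : ∀ t ∈ Set.Icc 0 T, htilde w 0 t = h w 0 (φ t) := by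
    induction w using List.reverseRecOn with
    | nil => intro t _; rw [htnil, hnil]
    | append_singleton w i ih =>
      intro t ht
      have hcv := integral_comp_mul_derivWithin_Icc_of_monotoneOn ht
        (hφC1.differentiableOn one_ne_zero) hφmono (fun u => h w 0 u * f i u)
      rw [hφ0] at hcv
      rw [htrec w i 0 t le_rfl ht.1 ht.2,
        hrec w i 0 (φ t) le_rfl (hφmaps ht).1 (hφmaps ht).2, ← hcv]
      refine integral_congr fun u hu => ?_
      rw [Set.uIcc_of_le ht.1] at hu
      simp only [ih u ⟨hu.1, hu.2.trans ht.2⟩, mul_assoc]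
  rw [key T hTmem, hφT]
end

section
/- Let p(x) = (1/(x√(2π))) · exp(−(log x)²/2) for x > 0 and q(x) = p(x) · (1 + sin(2π log x)). Define on (0,∞)² the product densities P(n₁,n₂) = p(n₁)p(n₂) and Q(m₁,m₂) = q(m₁)q(m₂). Then Q is a probability density on (0,∞)² (Q ≥ 0 and ∫∫ Q = 1), and for all j₁, j₂ ∈ ℕ the mixed moments agree: ∫∫_{(0,∞)²} n₁^{j₁} n₂^{j₂} P(n₁,n₂) dn₁ dn₂ = ∫∫_{(0,∞)²} m₁^{j₁} m₂^{j₂} Q(m₁,m₂) dm₁ dm₂ = exp(j₁²/2) · exp(j₂²/2), both integrals being finite, while P ≠ Q as functions. -/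
open MeasureTheory Real

/-- Substitution `x = exp y` in integrals over the positive half-line. -/
theorem setIntegral_Ioi_zero_eq_integral_exp_mul (g : ℝ → ℝ) :
    ∫ x in Set.Ioi 0, g x = ∫ y, exp y * g (exp y) := by
  rw [← range_exp, ← Set.image_univ]
  simpa [abs_of_pos (exp_pos _)] using integral_image_eq_integral_abs_deriv_smul
    MeasurableSet.univ (fun x _ ↦ (hasDerivAt_exp x).hasDerivWithinAt) exp_injective.injOn g

theorem integrableOn_Ioi_zero_iff_integrable_exp_mul (g : ℝ → ℝ) :
    IntegrableOn g (Set.Ioi 0) ↔ Integrable fun y ↦ exp y * g (exp y) := by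
  rw [← range_exp, ← Set.image_univ]
  simpa [abs_of_pos (exp_pos _)] using integrableOn_image_iff_integrableOn_abs_deriv_smul
    MeasurableSet.univ (fun x _ ↦ (hasDerivAt_exp x).hasDerivWithinAt) exp_injective.injOn g

theorem integrable_cexp_neg_sq_half_add (c : ℂ) :
    Integrable fun y : ℝ ↦ Complex.exp (-(1 / 2) * (y : ℂ) ^ 2 + c * y) := by
  simpa using integrable_cexp_quadratic (b := 1 / 2) (by norm_num) c 0

theorem integral_cexp_neg_sq_half_add (c : ℂ) :
    ∫ y : ℝ, Complex.exp (-(1 / 2) * (y : ℂ) ^ 2 + c * y) =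
      (√(2 * π) : ℝ) * Complex.exp (c ^ 2 / 2) := by
  have h := integral_cexp_quadratic (b := -(1 / 2)) (by norm_num) c 0
  simp only [add_zero] at h
  rw [h, sqrt_eq_rpow, Complex.ofReal_cpow (by positivity)]
  congr 2
  · push_cast
    ring
  · push_cast
    rfl
  · ring

theorem re_cexp_neg_sq_half_add (t y : ℝ) :
    (Complex.exp (-(1 / 2) * (y : ℂ) ^ 2 + t * y)).re = exp (t * y - y ^ 2 / 2) := by
  rw [← Complex.exp_ofReal_re]
  congr 2
  push_cast
  ring

theorem im_cexp_ofReal_add_ofReal_mul_I (u v : ℝ) :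
    (Complex.exp (u + v * Complex.I)).im = exp u * sin v := by
  simp [Complex.exp_im]

theorem im_cexp_neg_sq_half_add (t s y : ℝ) :
    (Complex.exp (-(1 / 2) * (y : ℂ) ^ 2 + (t + s * Complex.I) * y)).im =
      exp (t * y - y ^ 2 / 2) * sin (s * y) := by
  have : -(1 / 2) * (y : ℂ) ^ 2 + (t + s * Complex.I) * y =
      ((t * y - y ^ 2 / 2 : ℝ) : ℂ) + ((s * y : ℝ) : ℂ) * Complex.I := by
    push_cast
    ring
  rw [this, im_cexp_ofReal_add_ofReal_mul_I]

theorem integrable_exp_mul_sub_sq_half (t : ℝ) :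
    Integrable fun y : ℝ ↦ exp (t * y - y ^ 2 / 2) := by
  simpa only [RCLike.re_to_complex, re_cexp_neg_sq_half_add] using
    (integrable_cexp_neg_sq_half_add t).re

theorem integral_exp_mul_sub_sq_half (t : ℝ) :
    ∫ y : ℝ, exp (t * y - y ^ 2 / 2) = √(2 * π) * exp (t ^ 2 / 2) := by
  have h := integral_re (integrable_cexp_neg_sq_half_add t)
  simp only [RCLike.re_to_complex, re_cexp_neg_sq_half_add, integral_cexp_neg_sq_half_add] at h
  rw [h, Complex.re_ofReal_mul, ← Complex.exp_ofReal_re]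
  push_cast
  rfl

theorem integrable_exp_mul_sub_sq_half_mul_sin (t s : ℝ) :
    Integrable fun y : ℝ ↦ exp (t * y - y ^ 2 / 2) * sin (s * y) := by
  simpa only [RCLike.im_to_complex, im_cexp_neg_sq_half_add] using
    (integrable_cexp_neg_sq_half_add (t + s * Complex.I)).im

theorem integral_exp_mul_sub_sq_half_mul_sin (t s : ℝ) :
    ∫ y : ℝ, exp (t * y - y ^ 2 / 2) * sin (s * y) =
      √(2 * π) * (exp ((t ^ 2 - s ^ 2) / 2) * sin (t * s)) := by
  have h := integral_im (integrable_cexp_neg_sq_half_add (t + s * Complex.I))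
  simp only [RCLike.im_to_complex, im_cexp_neg_sq_half_add, integral_cexp_neg_sq_half_add] at h
  have hc : ((t : ℂ) + s * Complex.I) ^ 2 / 2 =
      (((t ^ 2 - s ^ 2) / 2 : ℝ) : ℂ) + ((t * s : ℝ) : ℂ) * Complex.I := by
    push_cast
    linear_combination (s : ℂ) ^ 2 / 2 * Complex.I_sq
  rw [h, hc, Complex.im_ofReal_mul, im_cexp_ofReal_add_ofReal_mul_I]

/-- The lognormal density, perturbed by the factor `1 + a * sin (2 * π * log x)`. -/
noncomputable def perturbedLognormal (a x : ℝ) : ℝ :=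
  1 / (x * √(2 * π)) * exp (-(log x) ^ 2 / 2) * (1 + a * sin (2 * π * log x))

theorem exp_mul_pow_mul_perturbedLognormal_exp (a : ℝ) (j : ℕ) (y : ℝ) :
    exp y * (exp y ^ j * perturbedLognormal a (exp y)) =
      (√(2 * π))⁻¹ * (exp (j * y - y ^ 2 / 2) +
        a * (exp (j * y - y ^ 2 / 2) * sin (2 * π * y))) := by
  have he : exp (j * y - y ^ 2 / 2) = exp y ^ j * exp (-y ^ 2 / 2) := by
    rw [← exp_nat_mul, ← exp_add]
    ring_nf
  rw [perturbedLognormal, log_exp, he]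
  have := exp_ne_zero y
  field_simp

theorem integrableOn_pow_mul_perturbedLognormal (a : ℝ) (j : ℕ) :
    IntegrableOn (fun x ↦ x ^ j * perturbedLognormal a x) (Set.Ioi 0) := by
  rw [integrableOn_Ioi_zero_iff_integrable_exp_mul]
  simp only [exp_mul_pow_mul_perturbedLognormal_exp]
  exact ((integrable_exp_mul_sub_sq_half j).add
    ((integrable_exp_mul_sub_sq_half_mul_sin j (2 * π)).const_mul a)).const_mul _

/-- The moments of the perturbed lognormal density do not depend on the perturbation. -/
theorem integral_pow_mul_perturbedLognormal (a : ℝ) (j : ℕ) :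
    ∫ x in Set.Ioi 0, x ^ j * perturbedLognormal a x = exp ((j : ℝ) ^ 2 / 2) := by
  have hs : sin (j * (2 * π)) = 0 := by simpa using sin_add_nat_mul_two_pi 0 j
  have hpi : √(2 * π) ≠ 0 := by positivity
  rw [setIntegral_Ioi_zero_eq_integral_exp_mul]
  simp only [exp_mul_pow_mul_perturbedLognormal_exp]
  rw [integral_const_mul, integral_add (integrable_exp_mul_sub_sq_half j)
    ((integrable_exp_mul_sub_sq_half_mul_sin j (2 * π)).const_mul a), integral_const_mul,
    integral_exp_mul_sub_sq_half, integral_exp_mul_sub_sq_half_mul_sin, hs]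
  field_simp
  simp

theorem integrableOn_pow_mul_pow_mul_of_eq_perturbedLognormal {f : ℝ → ℝ} {a : ℝ}
    (hf : ∀ x ∈ Set.Ioi (0 : ℝ), f x = perturbedLognormal a x) (j k : ℕ) :
    IntegrableOn (fun z : ℝ × ℝ ↦ z.1 ^ j * z.2 ^ k * (f z.1 * f z.2))
      (Set.Ioi 0 ×ˢ Set.Ioi 0) := by
  have h := (integrableOn_pow_mul_perturbedLognormal a j).mul_prod
    (integrableOn_pow_mul_perturbedLognormal a k)
  rw [Measure.prod_restrict] at h
  refine IntegrableOn.congr_fun h (fun z hz ↦ ?_) (measurableSet_Ioi.prod measurableSet_Ioi)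
  simp only [hf _ hz.1, hf _ hz.2]
  ring

theorem integral_pow_mul_pow_mul_of_eq_perturbedLognormal {f : ℝ → ℝ} {a : ℝ}
    (hf : ∀ x ∈ Set.Ioi (0 : ℝ), f x = perturbedLognormal a x) (j k : ℕ) :
    ∫ z in Set.Ioi (0 : ℝ) ×ˢ Set.Ioi (0 : ℝ), z.1 ^ j * z.2 ^ k * (f z.1 * f z.2) =
      exp ((j : ℝ) ^ 2 / 2) * exp ((k : ℝ) ^ 2 / 2) := by
  rw [← integral_pow_mul_perturbedLognormal a j, ← integral_pow_mul_perturbedLognormal a k,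
    ← setIntegral_prod_mul]
  refine setIntegral_congr_fun (measurableSet_Ioi.prod measurableSet_Ioi) fun z hz ↦ ?_
  simp only [hf _ hz.1, hf _ hz.2]
  ring

/-- The product densities `P(n₁,n₂) = p(n₁)p(n₂)` and
`Q(m₁,m₂) = q(m₁)q(m₂)` built from the lognormal density `p` and its perturbation `q`:
`Q` is a probability density on `(0,∞)²`, all mixed moments of `P` and `Q` agree and
equal `exp(j₁²/2)·exp(j₂²/2)`, yet `P ≠ Q`. -/
theorem lognormal_product_same_mixed_moments
    (p q : ℝ → ℝ)
    (hp : ∀ x ∈ Set.Ioi (0 : ℝ),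
      p x = (1 / (x * Real.sqrt (2 * π))) * Real.exp (-(Real.log x) ^ 2 / 2))
    (hq : ∀ x ∈ Set.Ioi (0 : ℝ), q x = p x * (1 + Real.sin (2 * π * Real.log x))) :
    (∀ z ∈ Set.Ioi (0 : ℝ) ×ˢ Set.Ioi (0 : ℝ), 0 ≤ q z.1 * q z.2) ∧
    IntegrableOn (fun z : ℝ × ℝ => q z.1 * q z.2) (Set.Ioi 0 ×ˢ Set.Ioi 0) ∧
    (∫ z in Set.Ioi (0 : ℝ) ×ˢ Set.Ioi (0 : ℝ), q z.1 * q z.2) = 1 ∧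
    (∀ j₁ j₂ : ℕ,
      IntegrableOn (fun z : ℝ × ℝ => z.1 ^ j₁ * z.2 ^ j₂ * (p z.1 * p z.2))
        (Set.Ioi 0 ×ˢ Set.Ioi 0) ∧
      IntegrableOn (fun z : ℝ × ℝ => z.1 ^ j₁ * z.2 ^ j₂ * (q z.1 * q z.2))
        (Set.Ioi 0 ×ˢ Set.Ioi 0) ∧
      (∫ z in Set.Ioi (0 : ℝ) ×ˢ Set.Ioi (0 : ℝ), z.1 ^ j₁ * z.2 ^ j₂ * (p z.1 * p z.2))
        = Real.exp ((j₁ : ℝ) ^ 2 / 2) * Real.exp ((j₂ : ℝ) ^ 2 / 2) ∧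
      (∫ z in Set.Ioi (0 : ℝ) ×ˢ Set.Ioi (0 : ℝ), z.1 ^ j₁ * z.2 ^ j₂ * (q z.1 * q z.2))
        = Real.exp ((j₁ : ℝ) ^ 2 / 2) * Real.exp ((j₂ : ℝ) ^ 2 / 2)) ∧
    ∃ z ∈ Set.Ioi (0 : ℝ) ×ˢ Set.Ioi (0 : ℝ), p z.1 * p z.2 ≠ q z.1 * q z.2 := by
  have hpa : ∀ x ∈ Set.Ioi (0 : ℝ), p x = perturbedLognormal 0 x := fun x hx ↦ by
    simp [hp x hx, perturbedLognormal]
  have hqa : ∀ x ∈ Set.Ioi (0 : ℝ), q x = perturbedLognormal 1 x := fun x hx ↦ by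
    simp [hq x hx, hp x hx, perturbedLognormal]
  have p_pos : ∀ x ∈ Set.Ioi (0 : ℝ), 0 < p x := fun x hx ↦ by
    have hx' : 0 < x := hx
    rw [hp x hx]
    positivity
  have q_nonneg : ∀ x ∈ Set.Ioi (0 : ℝ), 0 ≤ q x := fun x hx ↦ by
    rw [hq x hx]
    exact mul_nonneg (p_pos x hx).le (by linarith [neg_one_le_sin (2 * π * log x)])
  refine ⟨fun z hz ↦ mul_nonneg (q_nonneg _ hz.1) (q_nonneg _ hz.2), ?_, ?_, fun j₁ j₂ ↦
    ⟨integrableOn_pow_mul_pow_mul_of_eq_perturbedLognormal hpa j₁ j₂,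
      integrableOn_pow_mul_pow_mul_of_eq_perturbedLognormal hqa j₁ j₂,
      integral_pow_mul_pow_mul_of_eq_perturbedLognormal hpa j₁ j₂,
      integral_pow_mul_pow_mul_of_eq_perturbedLognormal hqa j₁ j₂⟩, ?_⟩
  · simpa using integrableOn_pow_mul_pow_mul_of_eq_perturbedLognormal hqa 0 0
  · simpa using integral_pow_mul_pow_mul_of_eq_perturbedLognormal hqa 0 0
  · have hx : exp (1 / 4) ∈ Set.Ioi (0 : ℝ) := exp_pos _
    have hqx : q (exp (1 / 4)) = 2 * p (exp (1 / 4)) := by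
      rw [hq _ hx, log_exp, show 2 * π * (1 / 4) = π / 2 by ring, sin_pi_div_two]
      ring
    refine ⟨(exp (1 / 4), exp (1 / 4)), ⟨hx, hx⟩, ?_⟩
    simp only [hqx]
    nlinarith [mul_pos (p_pos _ hx) (p_pos _ hx)]
end
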